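/- arXiv:2602.18463 — 4 statements merged into one kernel-verified Lean document; each statement's English description precedes it below -/
import Mathlib

section
/- For the Rössler templex digraph 𝒢_R with Poincaré edges Ē_R = {(3,1), (4,1)}: (i) for every nonempty closed directed walk c based at vertex 1, the list 𝒫(c) is a nonempty word over Ē_R; and (ii) for every nonempty finite word w over the two-letter alphabet Ē_R there exists a closed directed walk c based at vertex 1 with 𝒫(c) = w. Hence 𝒫 induces a bijection between the classes of nonempty closed walks based at 1 (two walks being identified when their 𝒫-images coincide) and the nonempty finite words over a two-letter alphabet; the generatex classes of the Rössler templex thus generate a free semigroup on the two generators G₁ and G₂. -/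
/-!
STATEMENT 13: For the Rössler templex digraph 𝒢_R with Poincaré edges
Ē_R = {(3,1),(4,1)}: (i) for every nonempty closed directed walk c based at
vertex 1, 𝒫(c) is a nonempty word over Ē_R; (ii) for every nonempty finite word
w over the two-letter alphabet Ē_R there is a closed directed walk c based at 1
with 𝒫(c) = w.  Hence 𝒫 induces a bijection between the classes of nonempty
closed walks based at 1 (identified when their 𝒫-images coincide) and the
nonempty finite words over a two-letter alphabet: the generatex classes generate
a free semigroup on the two generators G₁ and G₂ (concatenation of based closed
walks corresponding to concatenation of words).
-/

namespace Rossler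

/-- The edge set of the Rössler templex digraph 𝒢_R. -/
def rosslerE : Set (ℕ × ℕ) := {(1, 2), (2, 3), (2, 4), (3, 1), (4, 1)}

/-- The Poincaré edges of the Rössler templex. -/
def rosslerPE : Set (ℕ × ℕ) := {(3, 1), (4, 1)}

/-- The edge list of a walk given by its vertex list: the consecutive pairs. -/
def edgeList (l : List ℕ) : List (ℕ × ℕ) := l.zip l.tail

/-- A directed walk: every consecutive pair of vertices is a directed edge. -/
def IsWalk (E : Set (ℕ × ℕ)) (l : List ℕ) : Prop :=
  List.Chain' (fun u v => (u, v) ∈ E) l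

/-- A nonempty closed directed walk based at the vertex `v`. -/
def BasedClosedWalk (E : Set (ℕ × ℕ)) (v : ℕ) (l : List ℕ) : Prop :=
  IsWalk E l ∧ 2 ≤ l.length ∧ l.head? = some v ∧ l.getLast? = some v

/-- The Poincaré-edge operator 𝒫 of the Rössler templex: the sublist of the edge
list of a walk consisting of the edges in Ē_R = {(3,1),(4,1)}, in traversal order. -/
def P (l : List ℕ) : List (ℕ × ℕ) :=
  (edgeList l).filter (fun e => decide (e = (3, 1) ∨ e = (4, 1)))

/-- Two based closed walks are identified when their 𝒫-images coincide. -/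
instance pSetoid : Setoid {l : List ℕ // BasedClosedWalk rosslerE 1 l} :=
  ⟨fun a b => P a.1 = P b.1, ⟨fun _ => rfl, Eq.symm, Eq.trans⟩⟩

theorem isWalk_cons_cons (E : Set (ℕ × ℕ)) (a b : ℕ) (l : List ℕ) :
    IsWalk E (a :: b :: l) ↔ (a, b) ∈ E ∧ IsWalk E (b :: l) :=
  List.isChain_cons_cons

theorem P_cons_cons (a b : ℕ) (l : List ℕ) :
    P (a :: b :: l) =
      if (a, b) = (3, 1) ∨ (a, b) = (4, 1) then (a, b) :: P (b :: l) else P (b :: l) := by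
  simp [P, edgeList, List.filter_cons]

theorem mem_rosslerPE_of_mem_P {l : List ℕ} {e : ℕ × ℕ} (he : e ∈ P l) : e ∈ rosslerPE := by
  simpa [rosslerPE] using (List.mem_filter.1 he).2

/-- Every nontrivial walk ending at the vertex `1` traverses a Poincaré edge. -/
theorem P_ne_nil_of_isWalk (a b : ℕ) (l : List ℕ) (hw : IsWalk rosslerE (a :: b :: l))
    (hlast : (a :: b :: l).getLast? = some 1) : P (a :: b :: l) ≠ [] := by
  induction l generalizing a b with
  | nil =>
    obtain rfl : b = 1 := by simpa using hlast
    have he := (isWalk_cons_cons _ _ _ _).1 hw |>.1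
    rw [P_cons_cons, if_pos (by simpa [rosslerE] using he)]
    simp
  | cons c l ih =>
    have h := ih b c ((isWalk_cons_cons _ _ _ _).1 hw).2 (by simpa using hlast)
    rw [P_cons_cons]
    split_ifs
    · simp
    · exact h

/-- `P` turns concatenation of composable walks into concatenation of words. -/
theorem P_append_tail {v : ℕ} (a l : List ℕ) (ha : a.getLast? = some v) :
    P (a ++ l) = P a ++ P (v :: l) := by
  induction a with
  | nil => simp at ha
  | cons x a ih =>
    cases a with
    | nil =>
      obtain rfl : x = v := by simpa using ha
      simp [P, edgeList]
    | cons y a =>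
      have h := ih (by simpa using ha)
      simp only [List.cons_append] at h
      simp only [List.cons_append, P_cons_cons, h]
      split_ifs <;> rfl

/-- The closed walk based at `1` that runs through the loops `1 → 2 → e.1 → 1` for `e ∈ w`. -/
def loopWalk : List (ℕ × ℕ) → List ℕ
  | [] => [1]
  | e :: w => 1 :: 2 :: e.1 :: loopWalk w

theorem exists_loopWalk_eq_cons (w : List (ℕ × ℕ)) : ∃ t, loopWalk w = 1 :: t := by
  cases w <;> exact ⟨_, rfl⟩

theorem loopWalk_spec (w : List (ℕ × ℕ)) (hw : ∀ e ∈ w, e ∈ rosslerPE) :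
    IsWalk rosslerE (loopWalk w) ∧ (loopWalk w).getLast? = some 1 ∧ P (loopWalk w) = w := by
  induction w with
  | nil => exact ⟨List.isChain_singleton 1, rfl, rfl⟩
  | cons e w ih =>
    obtain ⟨hwalk, hlast, hP⟩ := ih fun x hx => hw x (List.mem_cons_of_mem _ hx)
    have he := hw e List.mem_cons_self
    obtain ⟨t, ht⟩ := exists_loopWalk_eq_cons w
    rw [ht] at hwalk hlast hP
    rw [loopWalk, ht]
    simp only [rosslerPE, Set.mem_insert_iff, Set.mem_singleton_iff] at he
    refine ⟨?_, by simpa using hlast, ?_⟩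
    · simp only [isWalk_cons_cons]
      rcases he with rfl | rfl <;> exact ⟨by simp [rosslerE], by simp [rosslerE],
        by simp [rosslerE], hwalk⟩
    · rcases he with rfl | rfl <;> simp [P_cons_cons, hP]

theorem exists_basedClosedWalk_P_eq (w : List (ℕ × ℕ)) (hne : w ≠ [])
    (hw : ∀ e ∈ w, e ∈ rosslerPE) :
    ∃ l : List ℕ, BasedClosedWalk rosslerE 1 l ∧ P l = w := by
  obtain ⟨hwalk, hlast, hP⟩ := loopWalk_spec w hw
  refine ⟨loopWalk w, ⟨hwalk, ?_, ?_, hlast⟩, hP⟩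
  · cases w with
    | nil => exact absurd rfl hne
    | cons e w => simp [loopWalk]
  · obtain ⟨t, ht⟩ := exists_loopWalk_eq_cons w
    simp [ht]

theorem BasedClosedWalk.P_ne_nil {l : List ℕ} (h : BasedClosedWalk rosslerE 1 l) :
    P l ≠ [] := by
  obtain ⟨hw, hlen, -, hlast⟩ := h
  match l, hlen with
  | a :: b :: l, _ => exact P_ne_nil_of_isWalk a b l hw hlast

/-- (i) 𝒫 sends every nonempty closed walk based at 1 to a nonempty word over
Ē_R; (ii) every nonempty word over Ē_R is 𝒫 of some closed walk based at 1;
𝒫 turns concatenation of based closed walks into concatenation of words; and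
the induced map on equivalence classes is injective with range exactly the
nonempty words over the two-letter alphabet Ē_R — i.e. the generatex classes of
the Rössler templex form a free semigroup on the two generators G₁ and G₂. -/
theorem rossler_free_semigroup :
    (∀ l : List ℕ, BasedClosedWalk rosslerE 1 l →
      P l ≠ [] ∧ ∀ e ∈ P l, e ∈ rosslerPE) ∧
    (∀ w : List (ℕ × ℕ), w ≠ [] → (∀ e ∈ w, e ∈ rosslerPE) →
      ∃ l : List ℕ, BasedClosedWalk rosslerE 1 l ∧ P l = w) ∧
    (∀ a b : List ℕ, BasedClosedWalk rosslerE 1 a → BasedClosedWalk rosslerE 1 b →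
      P (a ++ b.tail) = P a ++ P b) ∧
    Function.Injective
      (Quotient.lift (fun a : {l : List ℕ // BasedClosedWalk rosslerE 1 l} => P a.1)
        (fun _ _ h => h) : Quotient pSetoid → List (ℕ × ℕ)) ∧
    Set.range
      (Quotient.lift (fun a : {l : List ℕ // BasedClosedWalk rosslerE 1 l} => P a.1)
        (fun _ _ h => h) : Quotient pSetoid → List (ℕ × ℕ)) =
      {w : List (ℕ × ℕ) | w ≠ [] ∧ ∀ e ∈ w, e ∈ rosslerPE} := by
  refine ⟨fun l h => ⟨h.P_ne_nil, fun _ => mem_rosslerPE_of_mem_P⟩,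
    exists_basedClosedWalk_P_eq, ?_, ?_, ?_⟩
  · rintro a b ⟨-, -, -, ha⟩ ⟨-, -, hb, -⟩
    rw [P_append_tail a b.tail ha, List.cons_head?_tail hb]
  · rintro ⟨a⟩ ⟨b⟩ h
    exact Quotient.sound h
  · ext w
    constructor
    · rintro ⟨⟨l, h⟩, rfl⟩
      exact ⟨h.P_ne_nil, fun _ => mem_rosslerPE_of_mem_P⟩
    · rintro ⟨hne, hw⟩
      obtain ⟨l, h, hP⟩ := exists_basedClosedWalk_P_eq w hne hw
      exact ⟨Quotient.mk pSetoid ⟨l, h⟩, hP⟩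

end Rossler
end

section
/- In the speech-templex digraph 𝒢_S, every simple directed cycle is, up to cyclic rotation, one of G₁ = (7, 17, 9, 18, 20, 21, 15, 16, 7), G₂ = (7, 17, 9, 10, 11, 13, 14, 15, 16, 7), or G₃ = (1, 2, 3, 4, 5, 6, 7, 17, 9, 22, 23, 25, 19, 12, 1); in particular 𝒢_S has exactly three simple directed cycles up to cyclic rotation. -/
/-!
STATEMENT 14: In the speech-templex digraph 𝒢_S, every simple directed cycle is,
up to cyclic rotation, one of G₁ = (7,17,9,18,20,21,15,16,7),
G₂ = (7,17,9,10,11,13,14,15,16,7), or G₃ = (1,2,3,4,5,6,7,17,9,22,23,25,19,12,1);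
in particular 𝒢_S has exactly three simple directed cycles up to cyclic rotation.
-/

namespace Speech

/-- The generatex cycle G₁. -/
def G1 : List ℕ := [7, 17, 9, 18, 20, 21, 15, 16, 7]

/-- The generatex cycle G₂. -/
def G2 : List ℕ := [7, 17, 9, 10, 11, 13, 14, 15, 16, 7]

/-- The generatex cycle G₃. -/
def G3 : List ℕ := [1, 2, 3, 4, 5, 6, 7, 17, 9, 22, 23, 25, 19, 12, 1]

/-- The edge set of the speech-templex digraph 𝒢_S: the union of the edge sets
of the three cycles G₁, G₂, G₃. -/
def speechE : Set (ℕ × ℕ) :=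
  {(7, 17), (17, 9), (9, 18), (18, 20), (20, 21), (21, 15), (15, 16), (16, 7),
   (9, 10), (10, 11), (11, 13), (13, 14), (14, 15),
   (1, 2), (2, 3), (3, 4), (4, 5), (5, 6), (6, 7),
   (9, 22), (22, 23), (23, 25), (25, 19), (19, 12), (12, 1)}

/-- The edge list of a walk given by its vertex list: the consecutive pairs. -/
def edgeList (l : List ℕ) : List (ℕ × ℕ) := l.zip l.tail

/-- A directed walk: every consecutive pair of vertices is a directed edge. -/
def IsWalk (E : Set (ℕ × ℕ)) (l : List ℕ) : Prop :=
  List.Chain' (fun u v => (u, v) ∈ E) l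

/-- A nonempty closed directed walk: a directed walk with at least one edge whose
first and last vertices coincide. -/
def IsClosedWalk (E : Set (ℕ × ℕ)) (l : List ℕ) : Prop :=
  IsWalk E l ∧ 2 ≤ l.length ∧ l.head? = l.getLast?

/-- A simple directed cycle: a nonempty closed directed walk whose vertices are
pairwise distinct except for the coinciding endpoints. -/
def IsSimpleCycle (E : Set (ℕ × ℕ)) (l : List ℕ) : Prop :=
  IsClosedWalk E l ∧ l.dropLast.Nodup

/-- The edges of 𝒢_S as a list. -/
def speechEdges : List (ℕ × ℕ) :=
  [(7, 17), (17, 9), (9, 18), (18, 20), (20, 21), (21, 15), (15, 16), (16, 7),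
   (9, 10), (10, 11), (11, 13), (13, 14), (14, 15),
   (1, 2), (2, 3), (3, 4), (4, 5), (5, 6), (6, 7),
   (9, 22), (22, 23), (23, 25), (25, 19), (19, 12), (12, 1)]

theorem mem_speechE_iff (e : ℕ × ℕ) : e ∈ speechE ↔ e ∈ speechEdges := by
  simp only [speechE, speechEdges, List.mem_cons, List.not_mem_nil, or_false,
    Set.mem_insert_iff, Set.mem_singleton_iff]

/-- Depth-first search, with bounded depth, through the self-avoiding walks along `edges` that
extend the path `p.reverse ++ [u]`. The result is `true` only if the depth bound is never reached
and every extension that closes up at `s` satisfies `P`. -/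
def everyCompletion (edges : List (ℕ × ℕ)) (s : ℕ) (P : List ℕ → Bool) :
    ℕ → List ℕ → ℕ → Bool
  | 0, _, _ => false
  | k + 1, p, u => edges.all fun e =>
      e.1 != u || if e.2 = s then P (p.reverse ++ [u, s])
        else decide (e.2 ∈ u :: p) || everyCompletion edges s P k (u :: p) e.2

theorem everyCompletion_sound {edges : List (ℕ × ℕ)} {s : ℕ} {P : List ℕ → Bool} {k : ℕ}
    {p : List ℕ} {u : ℕ} (h : everyCompletion edges s P k p u = true) (hs : s ∈ u :: p)
    {t : List ℕ} (ht : t ≠ []) (hwalk : List.IsChain (fun a b => (a, b) ∈ edges) (u :: t))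
    (hlast : t.getLast? = some s) (hnodup : (p.reverse ++ u :: t.dropLast).Nodup) :
    P (p.reverse ++ u :: t) = true := by
  induction k generalizing p u t with
  | zero => simp [everyCompletion] at h
  | succ k ih =>
    obtain ⟨v, t, rfl⟩ := List.exists_cons_of_ne_nil ht
    rw [List.isChain_cons_cons] at hwalk
    have hstep := List.all_eq_true.mp h _ hwalk.1
    simp only [bne_self_eq_false, Bool.false_or] at hstep
    rcases eq_or_ne t [] with rfl | htne
    · obtain rfl : v = s := by simpa using hlast
      simpa using hstep
    · rw [List.dropLast_cons_of_ne_nil htne] at hnodup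
      have hv : v ∉ u :: p := by
        intro hv
        have hdisj := (List.nodup_append.mp (show ((p.reverse ++ [u]) ++ v :: t.dropLast).Nodup by
          simpa using hnodup)).2.2
        exact hdisj v (by simpa [or_comm] using hv) v (by simp) rfl
      have hvs : v ≠ s := fun hvs => hv (hvs ▸ hs)
      rw [if_neg hvs, decide_eq_false hv, Bool.false_or] at hstep
      have := ih hstep (List.mem_cons_of_mem v hs) htne hwalk.2
        (by rwa [List.getLast?_cons_of_ne_nil htne] at hlast) (by simpa using hnodup)
      simpa using this

/-- Being a cyclic rotation of one of the three generatex cycles. -/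
abbrev IsGeneratex (l : List ℕ) : Prop :=
  (edgeList l).IsRotated (edgeList G1) ∨ (edgeList l).IsRotated (edgeList G2) ∨
    (edgeList l).IsRotated (edgeList G3)

theorem everyCompletion_speechEdges : ∀ e ∈ speechEdges,
    everyCompletion speechEdges e.1 (fun l => decide (IsGeneratex l)) 24 [] e.1 = true := by
  decide +kernel

theorem IsSimpleCycle.isGeneratex {l : List ℕ} (h : IsSimpleCycle speechE l) :
    IsGeneratex l := by
  obtain ⟨⟨hwalk, hlen, hclosed⟩, hnodup⟩ := h
  obtain ⟨u, v, t, rfl⟩ : ∃ u v t, l = u :: v :: t := by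
    match l, hlen with
    | u :: v :: t, _ => exact ⟨u, v, t, rfl⟩
  have hchain : List.IsChain (fun a b => (a, b) ∈ speechEdges) (u :: v :: t) :=
    List.IsChain.imp (fun a b => (mem_speechE_iff (a, b)).mp) hwalk
  have huv := (List.isChain_cons_cons.mp hchain).1
  have := everyCompletion_sound (everyCompletion_speechEdges _ huv) (by simp)
    (List.cons_ne_nil v t) hchain (by simpa [List.getLast?_cons_cons] using hclosed.symm)
    (by simpa using hnodup)
  exact of_decide_eq_true this

theorem isSimpleCycle_speechE_iff (l : List ℕ) : IsSimpleCycle speechE l ↔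
    (List.IsChain (fun u v => (u, v) ∈ speechEdges) l ∧ 2 ≤ l.length ∧
      l.head? = l.getLast?) ∧ l.dropLast.Nodup := by
  simp only [← mem_speechE_iff]
  rfl

/-- G₁, G₂, G₃ are simple directed cycles of 𝒢_S, every simple directed cycle of
𝒢_S is a cyclic rotation of one of them, and no two of them are cyclic rotations
of each other: 𝒢_S has exactly three simple directed cycles up to cyclic rotation. -/
theorem speech_three_cycles :
    IsSimpleCycle speechE G1 ∧ IsSimpleCycle speechE G2 ∧ IsSimpleCycle speechE G3 ∧
    (∀ l : List ℕ, IsSimpleCycle speechE l →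
      (edgeList l).IsRotated (edgeList G1) ∨ (edgeList l).IsRotated (edgeList G2) ∨
      (edgeList l).IsRotated (edgeList G3)) ∧
    List.Pairwise (fun l l' => ¬ (edgeList l).IsRotated (edgeList l')) [G1, G2, G3] := by
  simp only [isSimpleCycle_speechE_iff G1, isSimpleCycle_speechE_iff G2,
    isSimpleCycle_speechE_iff G3]
  exact ⟨by decide +kernel, by decide +kernel, by decide +kernel,
    fun _ hl => hl.isGeneratex, by decide +kernel⟩

end Speech
end

section
/- In the speech-templex digraph 𝒢_S, every nonempty closed directed walk traverses at least one of the Poincaré edges (16,7) or (6,7) (the two edges entering the outgoing node 7); equivalently, the digraph obtained from 𝒢_S by deleting the edges (16,7) and (6,7) contains no directed cycle. -/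
/-!
STATEMENT 16: In the speech-templex digraph 𝒢_S, every nonempty closed directed
walk traverses at least one of the Poincaré edges (16,7) or (6,7) (the two edges
entering the outgoing node 7); equivalently, the digraph obtained from 𝒢_S by
deleting the edges (16,7) and (6,7) contains no directed cycle.
-/

namespace Speech

/-- A topological rank for the digraph obtained by deleting the two Poincaré edges. -/
def rank : ℕ → ℕ
  | 7 => 0 | 17 => 1 | 9 => 2
  | 18 => 3 | 20 => 4 | 21 => 5
  | 10 => 3 | 11 => 4 | 13 => 5 | 14 => 6
  | 15 => 7 | 16 => 8
  | 22 => 3 | 23 => 4 | 25 => 5 | 19 => 6 | 12 => 7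
  | 1 => 8 | 2 => 9 | 3 => 10 | 4 => 11 | 5 => 12 | 6 => 13
  | _ => 0

theorem rank_lt_of_mem {u v : ℕ} (h : (u, v) ∈ speechE \ {(16, 7), (6, 7)}) :
    rank u < rank v := by
  obtain ⟨h, h'⟩ := h
  simp only [speechE, Set.mem_insert_iff, Set.mem_singleton_iff, Prod.mk.injEq] at h h'
  rcases h with h | h | h | h | h | h | h | h | h | h | h | h | h | h | h | h | h | h | h | h |
    h | h | h | h | h <;> obtain ⟨rfl, rfl⟩ := h <;> first | decide | simp at h'

theorem isWalk_iff_forall_mem_edgeList {E : Set (ℕ × ℕ)} (l : List ℕ) :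
    IsWalk E l ↔ ∀ e ∈ edgeList l, e ∈ E := by
  change List.IsChain (fun u v => (u, v) ∈ E) l ↔ ∀ e ∈ l.zip l.tail, e ∈ E
  induction l with
  | nil => simp
  | cons a l ih =>
    cases l with
    | nil => simp
    | cons b l =>
      simp only [List.tail_cons] at ih
      simp only [List.isChain_cons_cons, ih, List.tail_cons, List.zip_cons_cons,
        List.forall_mem_cons]

/-- A strictly increasing rank along the edges excludes closed walks. -/
theorem not_isClosedWalk_of_rank {E : Set (ℕ × ℕ)} (r : ℕ → ℕ)
    (hr : ∀ u v, (u, v) ∈ E → r u < r v) (l : List ℕ) : ¬ IsClosedWalk E l := by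
  rintro ⟨hw, hlen, hcl⟩
  have hchain : List.IsChain (fun u v => r u < r v) l := List.IsChain.imp hr hw
  have : IsTrans ℕ (fun u v => r u < r v) := ⟨fun _ _ _ => lt_trans⟩
  have hp : l.Pairwise (fun u v => r u < r v) := List.isChain_iff_pairwise.mp hchain
  match l with
  | a :: b :: l =>
    rw [List.head?_cons, List.getLast?_cons_cons] at hcl
    have hmem : a ∈ b :: l := List.mem_of_getLast? hcl.symm
    exact lt_irrefl _ (List.rel_of_pairwise_cons hp hmem)

/-- Every nonempty closed directed walk in 𝒢_S traverses one of the Poincaré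
edges (16,7) or (6,7) entering the outgoing node 7; equivalently, after deleting
these two edges there is no nonempty closed directed walk (no directed cycle). -/
theorem speech_poincare_edges :
    (∀ l : List ℕ, IsClosedWalk speechE l →
      (16, 7) ∈ edgeList l ∨ (6, 7) ∈ edgeList l) ∧
    (∀ l : List ℕ, ¬ IsClosedWalk (speechE \ {(16, 7), (6, 7)}) l) := by
  have hacyclic := not_isClosedWalk_of_rank rank (fun _ _ => rank_lt_of_mem)
  refine ⟨fun l ⟨hw, hl⟩ => ?_, hacyclic⟩
  by_contra! hne
  refine hacyclic l ⟨(isWalk_iff_forall_mem_edgeList l).mpr fun e he => ⟨?_, ?_⟩, hl⟩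
  · exact (isWalk_iff_forall_mem_edgeList l).mp hw e he
  · rintro (rfl | rfl)
    exacts [hne.1 he, hne.2 he]

end Speech
end

section
/- In the wind-driven double-gyre templex digraph 𝒢_W, every simple directed cycle is, up to cyclic rotation, one of the six cycles G₁ = (1,2,3,4,1), G₂ = (1,2,3,5,6,17,18,19,20,21,22,1), G₃ = (1,2,3,5,6,12,13,1), G₄ = (1,2,3,5,6,7,8,1), G₅ = (1,2,3,5,6,9,10,11,1), G₆ = (1,2,3,5,6,14,15,16,1); in particular 𝒢_W has exactly six simple directed cycles up to cyclic rotation. -/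
/-!
STATEMENT 17: In the wind-driven double-gyre templex digraph 𝒢_W, every simple
directed cycle is, up to cyclic rotation, one of the six cycles
G₁ = (1,2,3,4,1), G₂ = (1,2,3,5,6,17,18,19,20,21,22,1), G₃ = (1,2,3,5,6,12,13,1),
G₄ = (1,2,3,5,6,7,8,1), G₅ = (1,2,3,5,6,9,10,11,1), G₆ = (1,2,3,5,6,14,15,16,1);
in particular 𝒢_W has exactly six simple directed cycles up to cyclic rotation.
-/

namespace Gyre

def G1 : List ℕ := [1, 2, 3, 4, 1]
def G2 : List ℕ := [1, 2, 3, 5, 6, 17, 18, 19, 20, 21, 22, 1]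
def G3 : List ℕ := [1, 2, 3, 5, 6, 12, 13, 1]
def G4 : List ℕ := [1, 2, 3, 5, 6, 7, 8, 1]
def G5 : List ℕ := [1, 2, 3, 5, 6, 9, 10, 11, 1]
def G6 : List ℕ := [1, 2, 3, 5, 6, 14, 15, 16, 1]

/-- The edge set of the wind-driven double-gyre templex digraph 𝒢_W: the union
of the edge sets of the six cycles G₁, …, G₆. -/
def gyreE : Set (ℕ × ℕ) :=
  {(1, 2), (2, 3), (3, 4), (4, 1), (3, 5), (5, 6),
   (6, 17), (17, 18), (18, 19), (19, 20), (20, 21), (21, 22), (22, 1),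
   (6, 12), (12, 13), (13, 1),
   (6, 7), (7, 8), (8, 1),
   (6, 9), (9, 10), (10, 11), (11, 1),
   (6, 14), (14, 15), (15, 16), (16, 1)}

/-- The edge list of a walk given by its vertex list: the consecutive pairs. -/
def edgeList (l : List ℕ) : List (ℕ × ℕ) := l.zip l.tail

/-- A directed walk: every consecutive pair of vertices is a directed edge. -/
def IsWalk (E : Set (ℕ × ℕ)) (l : List ℕ) : Prop :=
  List.Chain' (fun u v => (u, v) ∈ E) l

/-- A nonempty closed directed walk: a directed walk with at least one edge whose
first and last vertices coincide. -/
def IsClosedWalk (E : Set (ℕ × ℕ)) (l : List ℕ) : Prop :=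
  IsWalk E l ∧ 2 ≤ l.length ∧ l.head? = l.getLast?

/-- A simple directed cycle: a nonempty closed directed walk whose vertices are
pairwise distinct except for the coinciding endpoints. -/
def IsSimpleCycle (E : Set (ℕ × ℕ)) (l : List ℕ) : Prop :=
  IsClosedWalk E l ∧ l.dropLast.Nodup

/-- The edges of `gyreE` as a list. -/
def gyreEdges : List (ℕ × ℕ) :=
  [(1, 2), (2, 3), (3, 4), (4, 1), (3, 5), (5, 6),
   (6, 17), (17, 18), (18, 19), (19, 20), (20, 21), (21, 22), (22, 1),
   (6, 12), (12, 13), (13, 1),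
   (6, 7), (7, 8), (8, 1),
   (6, 9), (9, 10), (10, 11), (11, 1),
   (6, 14), (14, 15), (15, 16), (16, 1)]

theorem mem_gyreE_iff (e : ℕ × ℕ) : e ∈ gyreE ↔ e ∈ gyreEdges := by
  simp [gyreE, gyreEdges]

/-- The heads of the edges in `E` with tail `u`. -/
def successors (E : List (ℕ × ℕ)) (u : ℕ) : List ℕ :=
  (E.filter (fun e => e.1 == u)).map Prod.snd

theorem mem_successors {E : List (ℕ × ℕ)} {u v : ℕ} : v ∈ successors E u ↔ (u, v) ∈ E := by
  simp [successors]

/-- The simple paths with at most `n` vertices that start at `v` and avoid `used`, found by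
depth-first search. -/
def simplePaths (E : List (ℕ × ℕ)) : ℕ → List ℕ → ℕ → List (List ℕ)
  | 0, _, _ => []
  | n + 1, used, v =>
    if v ∈ used then []
    else [v] :: ((successors E v).flatMap (simplePaths E n (v :: used))).map (v :: ·)

theorem mem_simplePaths {E : List (ℕ × ℕ)} {n : ℕ} {used : List ℕ} {v : ℕ} {t : List ℕ}
    (hlen : (v :: t).length ≤ n) (hchain : (v :: t).IsChain (fun x y => (x, y) ∈ E))
    (hnodup : (v :: t).Nodup) (hused : ∀ x ∈ v :: t, x ∉ used) :
    v :: t ∈ simplePaths E n used v := by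
  induction t generalizing n used v with
  | nil =>
    obtain ⟨n, rfl⟩ : ∃ m, n = m + 1 := ⟨n - 1, by simp at hlen; omega⟩
    simp [simplePaths, hused v (by simp)]
  | cons w t ih =>
    obtain ⟨n, rfl⟩ : ∃ m, n = m + 1 := ⟨n - 1, by simp at hlen; omega⟩
    rw [List.isChain_cons_cons] at hchain
    rw [List.nodup_cons] at hnodup
    have hmem : w :: t ∈ simplePaths E n (v :: used) w := by
      refine ih (by simpa using hlen) hchain.2 hnodup.2 fun x hx hxv => ?_
      rcases List.mem_cons.1 hxv with rfl | hxu
      · exact hnodup.1 hx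
      · exact hused x (List.mem_cons_of_mem _ hx) hxu
    simp only [simplePaths, hused v (by simp), if_false]
    exact List.mem_cons_of_mem _ (List.mem_map_of_mem
      (List.mem_flatMap.2 ⟨w, mem_successors.2 hchain.1, hmem⟩))

theorem mem_Icc_of_mem_gyreEdges : ∀ e ∈ gyreEdges, e.1 ∈ Finset.Icc 1 22 := by
  decide +kernel

theorem isWalk_iff_isChain {E : Set (ℕ × ℕ)} {l : List ℕ} :
    IsWalk E l ↔ l.IsChain (fun u v => (u, v) ∈ E) :=
  Iff.rfl

/-- A simple cycle is a simple path closed up by an edge from its last vertex to its first. -/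
theorem IsSimpleCycle.exists_path {E : Set (ℕ × ℕ)} {l : List ℕ} (h : IsSimpleCycle E l) :
    ∃ a t, l = (a :: t) ++ [a] ∧ (a :: t).Nodup ∧
      ((a :: t) ++ [a]).IsChain (fun x y => (x, y) ∈ E) := by
  obtain ⟨⟨hwalk, hlen, hends⟩, hnodup⟩ := h
  obtain _ | ⟨a, t⟩ := l
  · simp at hlen
  obtain rfl | ⟨t, b, rfl⟩ := t.eq_nil_or_concat
  · simp at hlen
  obtain rfl : a = b := by simpa [List.getLast?_cons] using hends
  refine ⟨a, t, by simp, ?_, by simpa using isWalk_iff_isChain.1 hwalk⟩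
  rwa [List.concat_eq_append, ← List.cons_append, List.dropLast_concat] at hnodup

theorem forall_mem_Icc_of_isChain {a b : ℕ} {t : List ℕ}
    (h : ((a :: t) ++ [b]).IsChain (fun x y => (x, y) ∈ gyreEdges)) :
    ∀ x ∈ a :: t, x ∈ Finset.Icc 1 22 := by
  induction t generalizing a with
  | nil =>
    simp only [List.cons_append, List.nil_append, List.isChain_cons_cons] at h
    simpa using mem_Icc_of_mem_gyreEdges _ h.1
  | cons c t ih =>
    rw [List.cons_append, List.cons_append, List.isChain_cons_cons] at h
    rw [List.forall_mem_cons]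
    exact ⟨mem_Icc_of_mem_gyreEdges _ h.1, ih h.2⟩

theorem isRotated_of_mem_simplePaths : ∀ a ∈ Finset.Icc 1 22,
    ∀ p ∈ simplePaths gyreEdges 22 [] a, (∀ b ∈ p.getLast?, (b, a) ∈ gyreEdges) →
      ∃ g ∈ [G1, G2, G3, G4, G5, G6], (edgeList (p ++ [a])).IsRotated (edgeList g) := by
  decide +kernel

/-- G₁, …, G₆ are simple directed cycles of 𝒢_W, every simple directed cycle of
𝒢_W is a cyclic rotation of one of them, and no two of them are cyclic rotations
of each other: 𝒢_W has exactly six simple directed cycles up to cyclic rotation. -/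
theorem gyre_six_cycles :
    IsSimpleCycle gyreE G1 ∧ IsSimpleCycle gyreE G2 ∧ IsSimpleCycle gyreE G3 ∧
    IsSimpleCycle gyreE G4 ∧ IsSimpleCycle gyreE G5 ∧ IsSimpleCycle gyreE G6 ∧
    (∀ l : List ℕ, IsSimpleCycle gyreE l →
      (edgeList l).IsRotated (edgeList G1) ∨ (edgeList l).IsRotated (edgeList G2) ∨
      (edgeList l).IsRotated (edgeList G3) ∨ (edgeList l).IsRotated (edgeList G4) ∨
      (edgeList l).IsRotated (edgeList G5) ∨ (edgeList l).IsRotated (edgeList G6)) ∧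
    List.Pairwise (fun l l' => ¬ (edgeList l).IsRotated (edgeList l'))
      [G1, G2, G3, G4, G5, G6] := by
  have hG : ∀ l ∈ [G1, G2, G3, G4, G5, G6], IsSimpleCycle gyreE l := by
    simp only [IsSimpleCycle, IsClosedWalk, isWalk_iff_isChain, mem_gyreE_iff]
    decide +kernel
  simp only [List.forall_mem_cons] at hG
  obtain ⟨h1, h2, h3, h4, h5, h6, -⟩ := hG
  refine ⟨h1, h2, h3, h4, h5, h6, fun l hl => ?_, by decide +kernel⟩
  obtain ⟨a, t, rfl, hnodup, hchain⟩ := hl.exists_path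
  simp only [mem_gyreE_iff] at hchain
  have hIcc := forall_mem_Icc_of_isChain hchain
  have hlen : (a :: t).length ≤ 22 := by
    rw [← List.toFinset_card_of_nodup hnodup]
    exact Finset.card_le_card (t := Finset.Icc 1 22) fun x hx => hIcc x (List.mem_toFinset.1 hx)
  obtain ⟨hpath, -, hlast⟩ := List.isChain_append.1 hchain
  have := isRotated_of_mem_simplePaths a (hIcc a (by simp)) _
    (mem_simplePaths hlen hpath hnodup (by simp)) fun b hb => hlast b hb a (by simp)
  simpa using this

end Gyre
end
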